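/- arXiv:1309.1913 — 2 statements merged into one kernel-verified Lean document; each statement's English description precedes it below -/
import Mathlib

section
/- Let (Ω, F, P) be a probability space, (G_t)_{t ∈ [0,T]} a filtration of sub-σ-algebras of F with each G_t countably generated, A a compact metric space equipped with its Borel σ-algebra, g : [0,T] × Ω × A → ℝ bounded and jointly measurable, and u^o : [0,T] × Ω → A jointly measurable with u^o_t G_t-measurable for each t (an adapted control). Suppose the integrated variational inequality holds: for every jointly measurable u : [0,T] × Ω → A with u_t G_t-measurable for each t, ∫₀ᵀ E[ g(t, ·, u_t) − g(t, ·, u^o_t) ] dt ≥ 0. Then the pointwise conditional variational inequality holds: for every a ∈ A, for Lebesgue-a.e. t ∈ [0,T], E[ g(t, ·, a) | G_t ] ≥ E[ g(t, ·, u^o_t) | G_t ] P-almost surely. -/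
open MeasureTheory
open scoped RealInnerProductSpace

open scoped symmDiff

lemma aux_fixed_event
    {Ω : Type*} [MeasurableSpace Ω] (P : Measure Ω) [IsProbabilityMeasure P]
    (T : ℝ)
    (G : ℝ → MeasurableSpace Ω)
    (hGle : ∀ t, G t ≤ ‹MeasurableSpace Ω›)
    (hGmono : ∀ s t : ℝ, s ≤ t → G s ≤ G t)
    {A : Type*} [MeasurableSpace A]
    (g : ℝ → Ω → A → ℝ)
    (hgmeas : Measurable fun p : ℝ × Ω × A => g p.1 p.2.1 p.2.2)
    (M : ℝ) (hM : ∀ t ω a, |g t ω a| ≤ M)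
    (uo : ℝ → Ω → A)
    (huo_meas : Measurable fun p : ℝ × Ω => uo p.1 p.2)
    (huo_adapted : ∀ t, Measurable[G t] (uo t))
    (hVI : ∀ u : ℝ → Ω → A, (Measurable fun p : ℝ × Ω => u p.1 p.2) →
      (∀ t, Measurable[G t] (u t)) →
      0 ≤ ∫ t in Set.Icc (0 : ℝ) T, ∫ ω, (g t ω (u t ω) - g t ω (uo t ω)) ∂P)
    (a : A) (q : ℝ) (C : Set Ω) (hC : MeasurableSet[G q] C) :
    ∀ᵐ t ∂(MeasureTheory.volume.restrict (Set.Icc (0 : ℝ) T)),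
      q ≤ t → 0 ≤ ∫ ω in C, (g t ω a - g t ω (uo t ω)) ∂P := by
  classical
  have hC' : MeasurableSet C := hGle q C hC
  have hmeas : Measurable fun p : ℝ × Ω => g p.1 p.2 a - g p.1 p.2 (uo p.1 p.2) := by
    apply Measurable.sub
    · exact hgmeas.comp (measurable_fst.prodMk (measurable_snd.prodMk measurable_const))
    · exact hgmeas.comp (measurable_fst.prodMk (measurable_snd.prodMk huo_meas))
  have hφ : StronglyMeasurable fun t => ∫ ω in C, (g t ω a - g t ω (uo t ω)) ∂P :=
    hmeas.stronglyMeasurable.integral_prod_right'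
  have hbound : ∀ t, ‖∫ ω in C, (g t ω a - g t ω (uo t ω)) ∂P‖ ≤ 2 * M := by
    intro t
    have hM0 : 0 ≤ 2 * M := by
      have : Nonempty Ω := P.nonempty_of_neZero
      have := (abs_nonneg _).trans (hM 0 (Classical.arbitrary Ω) a)
      linarith
    have h1 := norm_setIntegral_le_of_norm_le_const (μ := P) (s := C) (C := 2 * M)
      (f := fun ω => g t ω a - g t ω (uo t ω)) (measure_lt_top _ _) (by
        intro ω _
        have h1 := abs_le.1 (hM t ω a)
        have h2 := abs_le.1 (hM t ω (uo t ω))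
        rw [Real.norm_eq_abs, abs_le]
        constructor <;> linarith [h1.1, h1.2, h2.1, h2.2])
    refine h1.trans ?_
    have : P.real C ≤ 1 := measureReal_le_one
    nlinarith
  have hint : Integrable (fun t => ∫ ω in C, (g t ω a - g t ω (uo t ω)) ∂P)
      (volume.restrict (Set.Icc (0 : ℝ) T)) := by
    refine Integrable.of_bound hφ.aestronglyMeasurable (2 * M) (Filter.Eventually.of_forall hbound)
  have key : 0 ≤ᵐ[(volume.restrict (Set.Icc (0 : ℝ) T)).restrict (Set.Ici q)]
      (fun t => ∫ ω in C, (g t ω a - g t ω (uo t ω)) ∂P) := by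
    refine ae_nonneg_of_forall_setIntegral_nonneg hint.restrict ?_
    intro S hS _
    rw [Measure.restrict_restrict hS]
    have hSq : MeasurableSet (S ∩ Set.Ici q) := hS.inter measurableSet_Ici
    have hv := hVI (fun t ω => if t ∈ S ∩ Set.Ici q ∧ ω ∈ C then a else uo t ω)
      (by
        refine Measurable.ite ?_ measurable_const huo_meas
        exact (hSq.prod hC'))
      (by
        intro t
        by_cases ht : t ∈ S ∩ Set.Ici q
        · simp only [ht, true_and]
          exact @Measurable.ite Ω A (fun _ => a) (uo t) (G t) _ (fun ω => ω ∈ C) _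
            (hGmono q t ht.2 C hC) (@measurable_const A Ω _ (G t) a) (huo_adapted t)
        · simp only [ht, false_and, if_false]
          exact huo_adapted t)
    rw [← integral_indicator hSq]
    refine hv.trans_eq ?_
    congr 1
    funext t
    symm
    by_cases ht : t ∈ S ∩ Set.Ici q
    · rw [Set.indicator_of_mem ht, ← integral_indicator hC']
      congr 1
      funext ω
      by_cases hω : ω ∈ C
      · simp [hω, ht.1, Set.mem_Ici.1 ht.2]
      · simp [hω]
    · rw [Set.indicator_of_notMem ht]
      simp only [ht, false_and, if_false, sub_self, integral_zero]
  exact (ae_restrict_iff' measurableSet_Ici).1 key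

/-- **From the integrated variational inequality to the pointwise conditional
variational inequality.**  Let `(G t)_{t ∈ [0,T]}` be a filtration of countably
generated sub-σ-algebras, `A` a compact metric space with its Borel σ-algebra,
`g : [0,T] × Ω × A → ℝ` bounded and jointly measurable, and `uᵒ` a jointly measurable
adapted control.  If for every jointly measurable adapted control `u`
`∫₀ᵀ E[ g(t,·,u_t) − g(t,·,uᵒ_t) ] dt ≥ 0`, then for every `a ∈ A`, for Lebesgue-a.e.
`t ∈ [0,T]`, `E[g(t,·,a) | G t] ≥ E[g(t,·,uᵒ_t) | G t]` P-a.s. -/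
theorem integrated_VI_implies_pointwise_conditional_VI
    {Ω : Type*} [MeasurableSpace Ω] (P : Measure Ω) [IsProbabilityMeasure P]
    (T : ℝ) (hT : 0 ≤ T)
    (G : ℝ → MeasurableSpace Ω)
    (hGle : ∀ t, G t ≤ ‹MeasurableSpace Ω›)
    (hGmono : ∀ s t : ℝ, s ≤ t → G s ≤ G t)
    (hGcg : ∀ t, @MeasurableSpace.CountablyGenerated Ω (G t))
    {A : Type*} [MetricSpace A] [CompactSpace A] [MeasurableSpace A] [BorelSpace A]
    (g : ℝ → Ω → A → ℝ)
    (hgmeas : Measurable fun p : ℝ × Ω × A => g p.1 p.2.1 p.2.2)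
    (hgbd : ∃ C : ℝ, ∀ t ω a, |g t ω a| ≤ C)
    (uo : ℝ → Ω → A)
    (huo_meas : Measurable fun p : ℝ × Ω => uo p.1 p.2)
    (huo_adapted : ∀ t, Measurable[G t] (uo t))
    -- integrated variational inequality:
    (hVI : ∀ u : ℝ → Ω → A, (Measurable fun p : ℝ × Ω => u p.1 p.2) →
      (∀ t, Measurable[G t] (u t)) →
      0 ≤ ∫ t in Set.Icc (0 : ℝ) T, ∫ ω, (g t ω (u t ω) - g t ω (uo t ω)) ∂P) :
    -- conclusion: pointwise conditional variational inequality
    ∀ a : A,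
      ∀ᵐ t ∂(MeasureTheory.volume.restrict (Set.Icc (0 : ℝ) T)),
        ∀ᵐ ω ∂P,
          (P[fun ω' => g t ω' (uo t ω') | G t]) ω ≤ (P[fun ω' => g t ω' a | G t]) ω := by
  intro a
  classical
  obtain ⟨M, hM⟩ := hgbd
  have hM0 : 0 ≤ M := by
    have : Nonempty Ω := P.nonempty_of_neZero
    exact (abs_nonneg _).trans (hM 0 (Classical.arbitrary Ω) a)
  -- countable dense family of events of `G T`
  obtain ⟨𝒜, h𝒜c, h𝒜d⟩ : ∃ 𝒜 : Set (Set Ω), 𝒜.Countable ∧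
      @Measure.MeasureDense Ω (G T) (P.trim (hGle T)) 𝒜 := by
    have := hGcg T
    have h : @IsSeparable Ω (G T) (P.trim (hGle T)) := inferInstance
    exact h.exists_countable_measureDense
  let S : Set Ω → ℚ → Set ℝ := fun B r =>
    {t | ∃ C, MeasurableSet[G t] C ∧ P (B ∆ C) < ENNReal.ofReal r}
  have hbad : (⋃ B ∈ 𝒜, ⋃ r : ℚ, {t | IsLeast (S B r) t}).Countable := by
    refine h𝒜c.biUnion fun B _ => Set.countable_iUnion fun r => ?_
    exact Set.Subsingleton.countable (fun x hx y hy => hx.unique hy)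
  have hgood : ∀ᵐ t ∂(volume.restrict (Set.Icc (0 : ℝ) T)),
      t ∉ ⋃ B ∈ 𝒜, ⋃ r : ℚ, {t | IsLeast (S B r) t} :=
    ae_restrict_of_ae (hbad.ae_notMem volume)
  let Cf : Set Ω → ℚ → ℚ → Set Ω := fun B r q =>
    if h : (q : ℝ) ∈ S B r then h.choose else ∅
  have hCf : ∀ B (r q : ℚ), MeasurableSet[G (q : ℝ)] (Cf B r q) := by
    intro B r q
    by_cases h : (q : ℝ) ∈ S B r
    · simp only [Cf, dif_pos h]; exact h.choose_spec.1
    · simp only [Cf, dif_neg h]; exact @MeasurableSet.empty _ (G q)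
  have hCf' : ∀ B (r q : ℚ), (q : ℝ) ∈ S B r → P (B ∆ Cf B r q) < ENNReal.ofReal r := by
    intro B r q h
    simp only [Cf, dif_pos h]; exact h.choose_spec.2
  have hall : ∀ᵐ t ∂(volume.restrict (Set.Icc (0 : ℝ) T)), ∀ B ∈ 𝒜, ∀ r q : ℚ,
      (q : ℝ) ≤ t → 0 ≤ ∫ ω in Cf B r q, (g t ω a - g t ω (uo t ω)) ∂P := by
    refine (ae_ball_iff h𝒜c).2 fun B _ => ae_all_iff.2 fun r => ae_all_iff.2 fun q => ?_
    exact aux_fixed_event P T G hGle hGmono g hgmeas M hM uo huo_meas huo_adapted hVI a q _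
      (hCf B r q)
  filter_upwards [hgood, hall, ae_restrict_mem measurableSet_Icc] with t ht1 ht2 htT
  have hm1 : Measurable fun ω => g t ω a :=
    hgmeas.comp (measurable_const.prodMk (measurable_id.prodMk measurable_const))
  have hm2 : Measurable fun ω => g t ω (uo t ω) :=
    hgmeas.comp (measurable_const.prodMk (measurable_id.prodMk
      ((huo_adapted t).mono (hGle t) le_rfl)))
  have hi1 : Integrable (fun ω => g t ω a) P :=
    Integrable.of_bound hm1.aestronglyMeasurable M (Filter.Eventually.of_forall fun ω => hM t ω a)
  have hi2 : Integrable (fun ω => g t ω (uo t ω)) P :=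
    Integrable.of_bound hm2.aestronglyMeasurable M (Filter.Eventually.of_forall fun ω => hM t ω _)
  have hpos : ∀ B, MeasurableSet[G t] B →
      0 ≤ ∫ ω in B, (g t ω a - g t ω (uo t ω)) ∂P := by
    intro B hB
    have happ : ∀ r : ℚ, 0 < r → - (4 * M * r) ≤ ∫ ω in B, (g t ω a - g t ω (uo t ω)) ∂P := by
      intro r hr
      have hr' : (0 : ℝ) < r := by exact_mod_cast hr
      have hBT : MeasurableSet[G T] B := hGmono t T htT.2 B hB
      obtain ⟨D, hD, hBD⟩ := @Measure.MeasureDense.approx Ω (G T) _ _ h𝒜d B hBT (by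
        rw [trim_measurableSet_eq (hGle T) hBT]; exact measure_ne_top P B) r hr'
      have hDm : MeasurableSet[G T] D := @Measure.MeasureDense.measurable Ω (G T) _ _ h𝒜d D hD
      rw [trim_measurableSet_eq (hGle T)
        (@MeasurableSet.symmDiff _ (G T) _ _ hBT hDm)] at hBD
      have htS : t ∈ S D r := ⟨B, hB, by rwa [symmDiff_comm]⟩
      have hnl : ¬ IsLeast (S D r) t := by
        intro h
        exact ht1 (Set.mem_biUnion hD (Set.mem_iUnion.2 ⟨r, h⟩))
      obtain ⟨s, hs, hst⟩ : ∃ s ∈ S D r, s < t := by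
        by_contra hcon
        push Not at hcon
        exact hnl ⟨htS, fun x hx => hcon x hx⟩
      obtain ⟨q, hsq, hqt⟩ := exists_rat_btwn hst
      have hqS : (q : ℝ) ∈ S D r := by
        obtain ⟨C, hC1, hC2⟩ := hs
        exact ⟨C, hGmono s q hsq.le C hC1, hC2⟩
      have hE := hCf' D r q hqS
      have hEpos := ht2 D hD r q hqt.le
      have hEm : MeasurableSet (Cf D r q) := hGle _ _ (hCf D r q)
      have hBm : MeasurableSet B := hGle _ _ hB
      generalize Cf D r q = E at hE hEpos hEm
      have hBE : P.real (B ∆ E) ≤ 2 * r := by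
        have h1 : P (B ∆ E) ≤ ENNReal.ofReal (2 * r) := by
          calc P (B ∆ E) ≤ P (B ∆ D) + P (D ∆ E) := measure_symmDiff_le B D E
            _ ≤ ENNReal.ofReal r + ENNReal.ofReal r := add_le_add hBD.le hE.le
            _ = ENNReal.ofReal (2 * r) := by
              rw [← ENNReal.ofReal_add hr'.le hr'.le, two_mul]
        exact ENNReal.toReal_le_of_le_ofReal (by positivity) h1
      have hfi : Integrable (fun ω => g t ω a - g t ω (uo t ω)) P := hi1.sub hi2
      have hle : ∀ ω, |g t ω a - g t ω (uo t ω)| ≤ 2 * M := by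
        intro ω
        have h1 := abs_le.1 (hM t ω a)
        have h2 := abs_le.1 (hM t ω (uo t ω))
        rw [abs_le]
        constructor <;> linarith [h1.1, h1.2, h2.1, h2.2]
      have hdiff : (∫ ω in E, (g t ω a - g t ω (uo t ω)) ∂P)
          - ∫ ω in B, (g t ω a - g t ω (uo t ω)) ∂P ≤ 2 * M * P.real (B ∆ E) := by
        rw [← integral_indicator hEm, ← integral_indicator hBm,
          ← integral_sub (hfi.indicator hEm) (hfi.indicator hBm)]
        have hsm : MeasurableSet (B ∆ E) := hBm.symmDiff hEm
        calc _ ≤ ∫ ω, (B ∆ E).indicator (fun _ => 2 * M) ω ∂P := by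
              refine integral_mono ((hfi.indicator hEm).sub (hfi.indicator hBm))
                ((integrable_const _).indicator hsm) ?_
              intro ω
              have := abs_le.1 (hle ω)
              by_cases h1 : ω ∈ B <;> by_cases h2 : ω ∈ E <;>
                simp [Set.indicator, Set.mem_symmDiff, h1, h2] <;> linarith [this.1, this.2]
          _ = _ := by
              rw [integral_indicator_const _ hsm, smul_eq_mul, mul_comm]
      nlinarith
    by_contra hneg
    push Not at hneg
    set I := ∫ ω in B, (g t ω a - g t ω (uo t ω)) ∂P
    obtain ⟨r, hr0, hr1⟩ := exists_rat_btwn (show (0 : ℝ) < -I / (4 * M + 1) by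
      apply div_pos <;> linarith)
    have := happ r (by exact_mod_cast hr0)
    rw [lt_div_iff₀ (by linarith)] at hr1
    nlinarith
  refine ae_le_of_ae_le_trim (hm := hGle t) ?_
  refine ae_le_of_forall_setIntegral_le (integrable_condExp.trim (hGle t) stronglyMeasurable_condExp)
    (integrable_condExp.trim (hGle t) stronglyMeasurable_condExp) ?_
  intro B hB _
  rw [← setIntegral_trim (hGle t) stronglyMeasurable_condExp hB,
    ← setIntegral_trim (hGle t) stronglyMeasurable_condExp hB,
    setIntegral_condExp (hGle t) hi2 hB, setIntegral_condExp (hGle t) hi1 hB]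
  have := hpos B hB
  rw [integral_sub hi1.integrableOn hi2.integrableOn] at this
  linarith
end

section
/- Let (Ω, F, P) be a probability space, H ⊆ F a sub-σ-algebra, Y : Ω → ℝ^k a random vector whose law is the standard Gaussian on ℝ^k and which is independent of H, Z : Ω → ℝ^k an H-measurable random vector, and D an invertible k×k real matrix. Then the common-denominator identity holds: E_P[ φ_k(D^{−1}(Y − Z)) / (|det D| · φ_k(Y)) | H ] = 1 P-almost surely; in particular the random variable Λ := φ_k(D^{−1}(Y − Z)) / (|det D| · φ_k(Y)) satisfies E_P[Λ] = 1. -/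
open MeasureTheory ProbabilityTheory

/-- The standard Gaussian density `φ_k(z) = (2π)^{-k/2} exp(-‖z‖²/2)` on `ℝ^k`. -/
noncomputable def gaussDensity (m : ℕ) (z : Fin m → ℝ) : ℝ :=
  (2 * Real.pi) ^ (-(m : ℝ) / 2) * Real.exp (-(∑ i, z i ^ 2) / 2)

/-- The standard Gaussian law on `ℝ^k`: the `k`-fold product of `gaussianReal 0 1`. -/
noncomputable def stdGaussianPi (m : ℕ) : Measure (Fin m → ℝ) :=
  Measure.pi fun _ => gaussianReal 0 1

lemma gaussDensity_eq_prod (m : ℕ) (z : Fin m → ℝ) :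
    gaussDensity m z = ∏ i, gaussianPDFReal 0 1 (z i) := by
  simp only [gaussDensity, gaussianPDFReal, Finset.prod_mul_distrib, Finset.prod_const,
    ← Real.exp_sum, Finset.card_univ, Fintype.card_fin]
  congr 1
  · rw [Real.sqrt_eq_rpow, ← Real.rpow_neg (by positivity), ← Real.rpow_natCast,
      ← Real.rpow_mul (by positivity)]
    simp only [NNReal.coe_one, mul_one]
    congr 1
    ring
  · simp [Finset.sum_div, neg_div, Finset.sum_neg_distrib]

lemma gaussDensity_pos (m : ℕ) (z : Fin m → ℝ) : 0 < gaussDensity m z := by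
  unfold gaussDensity
  positivity

lemma measurable_gaussDensity (m : ℕ) : Measurable (gaussDensity m) := by
  unfold gaussDensity
  fun_prop

lemma stdGaussianPi_eq (m : ℕ) :
    stdGaussianPi m = volume.withDensity (fun z => ENNReal.ofReal (gaussDensity m z)) := by
  unfold stdGaussianPi
  refine Measure.pi_eq fun s hs => ?_
  have hms : MeasurableSet (Set.univ.pi s) := MeasurableSet.univ_pi hs
  have hint : ∀ i, Integrable ((s i).indicator (gaussianPDFReal 0 1)) volume := fun i =>
    (integrable_gaussianPDFReal 0 1).indicator (hs i)
  have hnn : ∀ i x, 0 ≤ (s i).indicator (gaussianPDFReal 0 1) x := fun i x =>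
    Set.indicator_nonneg (fun _ _ => gaussianPDFReal_nonneg _ _ _) _
  have h1 : ∀ z : Fin m → ℝ, (Set.univ.pi s).indicator
      (fun z => ENNReal.ofReal (gaussDensity m z)) z
      = ENNReal.ofReal (∏ i, (s i).indicator (gaussianPDFReal 0 1) (z i)) := by
    intro z
    by_cases hz : z ∈ Set.univ.pi s
    · rw [Set.indicator_of_mem hz, gaussDensity_eq_prod]
      congr 1
      refine Finset.prod_congr rfl fun i _ => ?_
      rw [Set.indicator_of_mem (hz i (Set.mem_univ i))]
    · rw [Set.indicator_of_notMem hz]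
      simp only [Set.mem_pi, Set.mem_univ, true_imp_iff, not_forall] at hz
      obtain ⟨i, hi⟩ := hz
      rw [Finset.prod_eq_zero (Finset.mem_univ i) (Set.indicator_of_notMem hi _)]
      simp
  rw [withDensity_apply _ hms, ← lintegral_indicator hms]
  simp_rw [h1]
  rw [← ofReal_integral_eq_lintegral_ofReal, integral_fintype_prod_volume_eq_prod,
    ENNReal.ofReal_prod_of_nonneg]
  · refine Finset.prod_congr rfl fun i _ => ?_
    rw [gaussianReal_apply_eq_integral 0 one_ne_zero, integral_indicator (hs i)]
  · exact fun i _ => integral_nonneg (hnn i)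
  · exact Integrable.fintype_prod (f := fun i => (s i).indicator (gaussianPDFReal 0 1)) hint
  · exact Filter.Eventually.of_forall fun z => Finset.prod_nonneg fun i _ => hnn i _

instance (m : ℕ) : IsProbabilityMeasure (stdGaussianPi m) := by
  unfold stdGaussianPi; infer_instance

lemma lintegral_gaussDensity (m : ℕ) : ∫⁻ z, ENNReal.ofReal (gaussDensity m z) = 1 := by
  have h := measure_univ (μ := stdGaussianPi m)
  rwa [stdGaussianPi_eq, withDensity_apply _ MeasurableSet.univ, setLIntegral_univ] at h

lemma measurable_ratio {α : Type*} [MeasurableSpace α] {k : ℕ} (D : Matrix (Fin k) (Fin k) ℝ)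
    {u v : α → Fin k → ℝ} (hu : Measurable u) (hv : Measurable v) :
    Measurable (fun p => gaussDensity k (D⁻¹.mulVec (u p - v p)) /
        (|D.det| * gaussDensity k (u p))) := by
  have h : Measurable (fun v : Fin k → ℝ => D⁻¹.mulVec v) :=
    (Continuous.matrix_mulVec continuous_const continuous_id).measurable
  have h2 := measurable_gaussDensity k
  have h3 : Measurable (fun p => u p - v p) := hu.sub hv
  have h4 : Measurable (fun p => D⁻¹.mulVec (u p - v p)) := h.comp h3
  have h5 : Measurable (fun p => gaussDensity k (D⁻¹.mulVec (u p - v p))) := h2.comp h4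
  have h6 : Measurable (fun p => gaussDensity k (u p)) := h2.comp hu
  exact h5.div (h6.const_mul _)

lemma measurable_ratio_left {k : ℕ} (D : Matrix (Fin k) (Fin k) ℝ) (z : Fin k → ℝ) :
    Measurable (fun y : Fin k → ℝ => gaussDensity k (D⁻¹.mulVec (y - z)) /
        (|D.det| * gaussDensity k y)) :=
  measurable_ratio D (u := fun y => y) (v := fun _ => z) measurable_id measurable_const

lemma lintegral_ratio {k : ℕ} (D : Matrix (Fin k) (Fin k) ℝ) (hD : IsUnit D.det)
    (z : Fin k → ℝ) :
    ∫⁻ y, ENNReal.ofReal (gaussDensity k (D⁻¹.mulVec (y - z)) /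
        (|D.det| * gaussDensity k y)) ∂(stdGaussianPi k) = 1 := by
  have hd : D.det ≠ 0 := hD.ne_zero
  have hd' : (D⁻¹).det ≠ 0 := by
    rw [Matrix.det_nonsing_inv, Ring.inverse_eq_inv']
    exact inv_ne_zero hd
  have hm : Measurable (fun v : Fin k → ℝ => D⁻¹.mulVec v) :=
    (Continuous.matrix_mulVec continuous_const continuous_id).measurable
  have hg := measurable_gaussDensity k
  have hmap := Real.map_matrix_volume_pi_eq_smul_volume_pi hd'
  rw [stdGaussianPi_eq, lintegral_withDensity_eq_lintegral_mul _ hg.ennreal_ofReal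
    (measurable_ratio_left D z).ennreal_ofReal]
  have h1 : ∀ y : Fin k → ℝ, ((fun y => ENNReal.ofReal (gaussDensity k y)) *
      (fun y => ENNReal.ofReal (gaussDensity k (D⁻¹.mulVec (y - z)) /
        (|D.det| * gaussDensity k y)))) y
      = ENNReal.ofReal |D.det|⁻¹ * ENNReal.ofReal (gaussDensity k (D⁻¹.mulVec (y - z))) := by
    intro y
    have := gaussDensity_pos k y
    have hd2 : 0 < |D.det| := abs_pos.mpr hd
    simp only [Pi.mul_apply]
    rw [← ENNReal.ofReal_mul this.le, ← ENNReal.ofReal_mul (by positivity)]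
    congr 1
    field_simp
  rw [lintegral_congr h1, lintegral_const_mul _ (by fun_prop),
    lintegral_sub_right_eq_self (fun y => ENNReal.ofReal (gaussDensity k (D⁻¹.mulVec y))) z]
  have h2 : ∫⁻ y, ENNReal.ofReal (gaussDensity k (D⁻¹.mulVec y))
      = ∫⁻ y, ENNReal.ofReal (gaussDensity k y)
        ∂(Measure.map (Matrix.toLin' D⁻¹) volume) := by
    rw [lintegral_map hg.ennreal_ofReal (by exact hm)]
    rfl
  rw [h2, hmap, lintegral_smul_measure, lintegral_gaussDensity, Matrix.det_nonsing_inv,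
    Ring.inverse_eq_inv', inv_inv, smul_eq_mul, mul_one, ← ENNReal.ofReal_mul (by positivity),
    inv_mul_cancel₀ (abs_pos.mpr hd).ne', ENNReal.ofReal_one]

lemma setLIntegral_ratio
    {Ω : Type*} {H : MeasurableSpace Ω} [mΩ : MeasurableSpace Ω]
    (P : Measure Ω) [IsProbabilityMeasure P]
    {k : ℕ} (hH : H ≤ mΩ)
    (Y : Ω → Fin k → ℝ) (hYmeas : Measurable Y)
    (hYlaw : P.map Y = stdGaussianPi k)
    (hYindep : Indep (MeasurableSpace.comap Y inferInstance) H P)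
    (Z : Ω → Fin k → ℝ) (hZ : Measurable[H] Z)
    (D : Matrix (Fin k) (Fin k) ℝ) (hD : IsUnit D.det) (A : Set Ω) (hA : MeasurableSet[H] A) :
    ∫⁻ ω in A, ENNReal.ofReal (gaussDensity k (D⁻¹.mulVec (Y ω - Z ω)) /
        (|D.det| * gaussDensity k (Y ω))) ∂P = P A := by
  let W : Ω → (Fin k → ℝ) × ENNReal := fun ω => (Z ω, A.indicator 1 ω)
  have hWH : Measurable[H] W :=
    Measurable.prodMk hZ (Measurable.indicator (@measurable_const ENNReal Ω _ H 1) hA)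
  have hW : Measurable W := hWH.mono hH le_rfl
  have hind : IndepFun Y W P := by
    rw [IndepFun_iff_Indep]
    exact indep_of_indep_of_le_right hYindep hWH.comap_le
  have hlaw := (indepFun_iff_map_prod_eq_prod_map_map hYmeas.aemeasurable hW.aemeasurable).1 hind
  have : IsProbabilityMeasure (P.map W) := Measure.isProbabilityMeasure_map hW.aemeasurable
  have hF : Measurable (fun p : (Fin k → ℝ) × ((Fin k → ℝ) × ENNReal) =>
      p.2.2 * ENNReal.ofReal (gaussDensity k (D⁻¹.mulVec (p.1 - p.2.1)) /
        (|D.det| * gaussDensity k p.1))) :=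
    (measurable_snd.comp measurable_snd).mul (measurable_ratio D
      measurable_fst (measurable_fst.comp measurable_snd)).ennreal_ofReal
  have key := lintegral_map (μ := P) hF (hYmeas.prodMk hW)
  rw [hlaw, hYlaw, lintegral_prod_symm _ hF.aemeasurable] at key
  have hin : ∀ w : (Fin k → ℝ) × ENNReal, ∫⁻ y, w.2 * ENNReal.ofReal
      (gaussDensity k (D⁻¹.mulVec (y - w.1)) / (|D.det| * gaussDensity k y)) ∂(stdGaussianPi k)
      = w.2 := by
    intro w
    rw [lintegral_const_mul _ (measurable_ratio_left D w.1).ennreal_ofReal, lintegral_ratio D hD, mul_one]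
  rw [lintegral_congr hin, lintegral_map measurable_snd hW] at key
  rw [← lintegral_indicator (hH _ hA)]
  have hl : ∫⁻ ω, (W ω).2 ∂P = P A := by
    simp only [W]
    rw [lintegral_indicator_one (hH _ hA)]
  rw [← hl, key]
  refine lintegral_congr fun ω => ?_
  by_cases h : ω ∈ A <;> simp [W, h]

lemma condExp_of_setLIntegral
    {Ω : Type*} {H : MeasurableSpace Ω} [mΩ : MeasurableSpace Ω]
    (P : Measure Ω) [IsProbabilityMeasure P] (hH : H ≤ mΩ) (f : Ω → ℝ)
    (hnn : ∀ ω, 0 ≤ f ω) (hfm : Measurable f)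
    (hL : ∀ A, MeasurableSet[H] A → ∫⁻ ω in A, ENNReal.ofReal (f ω) ∂P = P A) :
    (P[f | H] =ᵐ[P] fun _ => 1) ∧ ∫ ω, f ω ∂P = 1 := by
  have hset : ∀ A, MeasurableSet[H] A → ∫ ω in A, f ω ∂P = P.real A := by
    intro A hA
    rw [integral_eq_lintegral_of_nonneg_ae (Filter.Eventually.of_forall hnn)
      hfm.aestronglyMeasurable, hL A hA, Measure.real]
  have huniv := hL Set.univ (@MeasurableSet.univ _ H)
  rw [setLIntegral_univ, measure_univ] at huniv
  have hfi : Integrable f P := by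
    refine ⟨hfm.aestronglyMeasurable, ?_⟩
    rw [hasFiniteIntegral_iff_ofReal (Filter.Eventually.of_forall hnn), huniv]
    exact ENNReal.one_lt_top
  refine ⟨?_, ?_⟩
  · symm
    refine ae_eq_condExp_of_forall_setIntegral_eq hH hfi (fun s _ _ => ?_) (fun s hs _ => ?_) ?_
    · exact (integrable_const _).integrableOn
    · rw [hset s hs]
      simp
    · exact aestronglyMeasurable_const
  · have := hset Set.univ (@MeasurableSet.univ _ H)
    simpa using this

/-- **The common-denominator identity.**  If `Y` is standard Gaussian on `ℝ^k`,
independent of the sub-σ-algebra `H`, `Z` is `H`-measurable and `D` is an invertible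
`k×k` matrix, then `E[ φ_k(D⁻¹(Y − Z)) / (|det D| φ_k(Y)) | H ] = 1` a.s.; in
particular `Λ := φ_k(D⁻¹(Y − Z)) / (|det D| φ_k(Y))` has expectation `1`. -/
theorem common_denominator_identity
    {Ω : Type*} {H : MeasurableSpace Ω} [mΩ : MeasurableSpace Ω]
    (P : Measure Ω) [IsProbabilityMeasure P]
    {k : ℕ} (hH : H ≤ mΩ)
    (Y : Ω → Fin k → ℝ) (hYmeas : Measurable Y)
    (hYlaw : P.map Y = stdGaussianPi k)
    (hYindep : Indep (MeasurableSpace.comap Y inferInstance) H P)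
    (Z : Ω → Fin k → ℝ) (hZ : Measurable[H] Z)
    (D : Matrix (Fin k) (Fin k) ℝ) (hD : IsUnit D.det) :
    (P[fun ω => gaussDensity k (D⁻¹.mulVec (Y ω - Z ω)) /
        (|D.det| * gaussDensity k (Y ω)) | H]
      =ᵐ[P] fun _ => 1) ∧
    ∫ ω, gaussDensity k (D⁻¹.mulVec (Y ω - Z ω)) /
        (|D.det| * gaussDensity k (Y ω)) ∂P = 1 := by
  refine condExp_of_setLIntegral P hH _ (fun ω => ?_) ?_
    (setLIntegral_ratio P hH Y hYmeas hYlaw hYindep Z hZ D hD)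
  · exact div_nonneg (gaussDensity_pos _ _).le
      (mul_nonneg (abs_nonneg _) (gaussDensity_pos _ _).le)
  · exact measurable_ratio D hYmeas (hZ.mono hH le_rfl)
end
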